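/- (Green's function of the Helmholtz operator in ℝ³.) Let α > 0 and define g_α : ℝ³ \ {0} → ℝ by g_α(x) = exp(−‖x‖/α) / (4π α² ‖x‖). Then for every smooth compactly supported function φ : ℝ³ → ℝ, the function x ↦ g_α(x)·(φ(x) − α² Δφ(x)) is integrable on ℝ³ and ∫_{ℝ³} g_α(x) ( φ(x) − α² Δφ(x) ) dx = φ(0). -/

import Mathlib

open MeasureTheory

noncomputable section

abbrev E3 := EuclideanSpace ℝ (Fin 3)

/-- Partial derivative `∂_j φ` of a scalar field on Euclidean ℝ³. -/
def pdE (j : Fin 3) (φ : E3 → ℝ) (x : E3) : ℝ := fderiv ℝ φ x (EuclideanSpace.single j 1)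

/-- Scalar Laplacian on Euclidean ℝ³. -/
def lapE (φ : E3 → ℝ) (x : E3) : ℝ := ∑ j, pdE j (fun y => pdE j φ y) x

/-- The Yukawa potential `g_α(x) = exp(−‖x‖/α)/(4πα²‖x‖)`. -/
def gA (α : ℝ) (x : E3) : ℝ := Real.exp (-‖x‖ / α) / (4 * Real.pi * α ^ 2 * ‖x‖)

lemma lapE_radial {u u₁ u₂ : ℝ → ℝ} {c : ℝ} (hc : 0 < c)
    (h : ∀ s, 0 < s → HasDerivAt u (u₁ s) s) (h₁ : ∀ s, 0 < s → HasDerivAt u₁ (u₂ s) s)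
    (x : E3) :
    lapE (fun y => u (‖y‖ ^ 2 + c)) x =
      6 * u₁ (‖x‖ ^ 2 + c) + 4 * ‖x‖ ^ 2 * u₂ (‖x‖ ^ 2 + c) := by
  have key : ∀ {v v₁ : ℝ → ℝ}, (∀ s, 0 < s → HasDerivAt v (v₁ s) s) → ∀ y : E3,
      HasFDerivAt (fun y : E3 => v (‖y‖ ^ 2 + c))
        (v₁ (‖y‖ ^ 2 + c) • ((2 : ℝ) • innerSL ℝ y)) y := by
    intro v v₁ hv y
    have := (hasStrictFDerivAt_norm_sq y).hasFDerivAt.add_const c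
    exact HasDerivAt.comp_hasFDerivAt y (hv _ (by positivity)) (by simpa [two_smul] using this)
  have hfst : ∀ j : Fin 3, (fun y => pdE j (fun y => u (‖y‖ ^ 2 + c)) y) =
      fun y : E3 => 2 * y j * u₁ (‖y‖ ^ 2 + c) := by
    intro j
    ext y
    simp only [pdE, (key h y).fderiv]
    simp [EuclideanSpace.inner_single_right]
    ring
  have hsnd : ∀ j : Fin 3, pdE j (fun y => pdE j (fun y => u (‖y‖ ^ 2 + c)) y) x =
      2 * u₁ (‖x‖ ^ 2 + c) + 4 * x j ^ 2 * u₂ (‖x‖ ^ 2 + c) := by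
    intro j
    rw [hfst j]
    have hcoord : HasFDerivAt (fun y : E3 => 2 * y j)
        ((2 : ℝ) • (EuclideanSpace.proj j : E3 →L[ℝ] ℝ)) x :=
      ((EuclideanSpace.proj j : E3 →L[ℝ] ℝ).hasFDerivAt).const_mul 2
    have : HasFDerivAt (fun y : E3 => 2 * y j * u₁ (‖y‖ ^ 2 + c)) _ x := hcoord.mul (key h₁ x)
    rw [pdE, this.fderiv]
    simp [EuclideanSpace.inner_single_right]
    ring
  simp only [lapE, hsnd, EuclideanSpace.real_norm_sq_eq x, Fin.sum_univ_three]
  ring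

lemma contDiff_pdE {n m : WithTop ℕ∞} {f : E3 → ℝ} (hf : ContDiff ℝ n f) (hmn : m + 1 ≤ n)
    (j : Fin 3) : ContDiff ℝ m (fun x => pdE j f x) :=
  (hf.fderiv_right hmn).clm_apply contDiff_const

lemma continuous_lapE {f : E3 → ℝ} (hf : ContDiff ℝ 2 f) : Continuous (lapE f) :=
  continuous_finsetSum _ fun j _ =>
    (contDiff_pdE (m := 0) (contDiff_pdE (m := 1) hf (by norm_num) j) (by norm_num) j).continuous

lemma hasCompactSupport_pdE {f : E3 → ℝ} (hf : HasCompactSupport f) (j : Fin 3) :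
    HasCompactSupport (fun x => pdE j f x) :=
  hf.fderiv_apply ℝ _

lemma hasCompactSupport_lapE {f : E3 → ℝ} (hf : HasCompactSupport f) :
    HasCompactSupport (lapE f) := by
  have h (j : Fin 3) := hasCompactSupport_pdE (hasCompactSupport_pdE hf j) j
  have : lapE f = fun x => pdE 0 (fun y => pdE 0 f y) x + pdE 1 (fun y => pdE 1 f y) x +
      pdE 2 (fun y => pdE 2 f y) x := by
    ext x
    simp [lapE, Fin.sum_univ_three]
  rw [this]
  exact ((h 0).add (h 1)).add (h 2)

lemma integral_mul_pdE {f g : E3 → ℝ} (hf : ContDiff ℝ 1 f) (hg : ContDiff ℝ 1 g)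
    (hsupp : HasCompactSupport g) (j : Fin 3) :
    ∫ x, f x * pdE j g x = - ∫ x, pdE j f x * g x := by
  have hf' := (contDiff_pdE (m := 0) hf (by norm_num) j).continuous
  have hg' := (contDiff_pdE (m := 0) hg (by norm_num) j).continuous
  exact integral_mul_fderiv_eq_neg_fderiv_mul_of_integrable
    ((hf'.mul hg.continuous).integrable_of_hasCompactSupport hsupp.mul_left)
    ((hf.continuous.mul hg').integrable_of_hasCompactSupport
      (hasCompactSupport_pdE hsupp j).mul_left)
    ((hf.continuous.mul hg.continuous).integrable_of_hasCompactSupport hsupp.mul_left)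
    (fun x _ => (hf.differentiable (by norm_num)).differentiableAt)
    (fun x _ => (hg.differentiable (by norm_num)).differentiableAt)

/-- Green's second identity on `ℝ³` against a compactly supported function. -/
lemma integral_mul_lapE {f g : E3 → ℝ} (hf : ContDiff ℝ 2 f) (hg : ContDiff ℝ 2 g)
    (hsupp : HasCompactSupport g) : ∫ x, f x * lapE g x = ∫ x, lapE f x * g x := by
  have hf₁ (j : Fin 3) := contDiff_pdE (m := 1) hf (by norm_num) j
  have hg₁ (j : Fin 3) := contDiff_pdE (m := 1) hg (by norm_num) j
  have hs₁ (j : Fin 3) := hasCompactSupport_pdE hsupp j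
  simp only [lapE, Finset.mul_sum, Finset.sum_mul]
  rw [integral_finsetSum, integral_finsetSum]
  · refine Finset.sum_congr rfl fun j _ => ?_
    rw [integral_mul_pdE (hf.of_le (by norm_num)) (hg₁ j) (hs₁ j),
      integral_mul_pdE (hf₁ j) (hg.of_le (by norm_num)) hsupp, neg_neg]
  · exact fun j _ => (((contDiff_pdE (m := 0) (hf₁ j) (by norm_num) j).continuous.mul
      hg.continuous).integrable_of_hasCompactSupport hsupp.mul_left)
  · exact fun j _ => ((hf.continuous.mul (contDiff_pdE (m := 0) (hg₁ j) (by norm_num)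
      j).continuous).integrable_of_hasCompactSupport (hasCompactSupport_pdE (hs₁ j) j).mul_left)

/-- The potential `exp (-r / α) / r` evaluated at `r = √(‖x‖² + ε²)`. -/
def regularizedYukawa (α ε : ℝ) (x : E3) : ℝ :=
  Real.exp (-√(‖x‖ ^ 2 + ε ^ 2) / α) / √(‖x‖ ^ 2 + ε ^ 2)

lemma contDiff_regularizedYukawa {α ε : ℝ} (hε : 0 < ε) {n : WithTop ℕ∞} :
    ContDiff ℝ n (regularizedYukawa α ε) := by
  have h : ContDiff ℝ n fun x : E3 => √(‖x‖ ^ 2 + ε ^ 2) :=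
    ((contDiff_norm_sq ℝ).add contDiff_const).sqrt fun x =>
      ne_of_gt (show 0 < ‖x‖ ^ 2 + ε ^ 2 by positivity)
  exact (h.neg.div_const α).exp.div h fun x =>
    (Real.sqrt_pos.2 (show 0 < ‖x‖ ^ 2 + ε ^ 2 by positivity)).ne'

lemma hasDerivAt_exp_neg_sqrt_div_sqrt {α s : ℝ} (hα : 0 < α) (hs : 0 < s) :
    HasDerivAt (fun s => Real.exp (-√s / α) / √s)
      (-(Real.exp (-√s / α) * (√s / α + 1) / (2 * √s ^ 3))) s := by
  have h := Real.hasDerivAt_sqrt hs.ne'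
  have hr : 0 < √s := Real.sqrt_pos.2 hs
  refine ((h.neg.div_const α).exp.div h hr.ne').congr_deriv ?_
  simp only [Pi.neg_apply]
  field_simp
  ring

lemma hasDerivAt_deriv_exp_neg_sqrt_div_sqrt {α s : ℝ} (hα : 0 < α) (hs : 0 < s) :
    HasDerivAt (fun s => -(Real.exp (-√s / α) * (√s / α + 1) / (2 * √s ^ 3)))
      (Real.exp (-√s / α) * ((√s / α) ^ 2 + 3 * (√s / α) + 3) / (4 * √s ^ 5)) s := by
  have h := Real.hasDerivAt_sqrt hs.ne'
  have hr : 0 < √s := Real.sqrt_pos.2 hs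
  refine ((((h.neg.div_const α).exp.mul ((h.div_const α).add_const 1)).div
    ((h.pow 3).const_mul 2) (show 2 * √s ^ 3 ≠ 0 by positivity)).neg).congr_deriv ?_
  simp only [Pi.neg_apply, Pi.pow_apply, Pi.mul_apply]
  field_simp
  ring

lemma regularizedYukawa_sub_lapE {α ε : ℝ} (hα : 0 < α) (hε : 0 < ε) (x : E3) :
    regularizedYukawa α ε x - α ^ 2 * lapE (regularizedYukawa α ε) x =
      α ^ 2 * ε ^ 2 * (Real.exp (-√(‖x‖ ^ 2 + ε ^ 2) / α) *
        ((√(‖x‖ ^ 2 + ε ^ 2) / α) ^ 2 + 3 * (√(‖x‖ ^ 2 + ε ^ 2) / α) + 3) /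
          √(‖x‖ ^ 2 + ε ^ 2) ^ 5) := by
  have h := lapE_radial (sq_pos_of_pos hε) (fun s => hasDerivAt_exp_neg_sqrt_div_sqrt hα)
    (fun s => hasDerivAt_deriv_exp_neg_sqrt_div_sqrt hα) x
  change lapE (regularizedYukawa α ε) x = _ at h
  rw [h, regularizedYukawa]
  have hr : 0 < √(‖x‖ ^ 2 + ε ^ 2) := Real.sqrt_pos.2 (by positivity)
  have hx : ‖x‖ ^ 2 = √(‖x‖ ^ 2 + ε ^ 2) ^ 2 - ε ^ 2 := by
    rw [Real.sq_sqrt (by positivity)]; ring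
  set r := √(‖x‖ ^ 2 + ε ^ 2)
  rw [hx]
  field_simp
  ring

open Filter Topology in
lemma tendsto_div_sqrt_one_add_sq : Tendsto (fun r : ℝ => r / √(1 + r ^ 2)) atTop (𝓝 1) := by
  have h : Tendsto (fun r : ℝ => (√((r⁻¹) ^ 2 + 1))⁻¹) atTop (𝓝 (√(0 ^ 2 + 1))⁻¹) :=
    (((tendsto_inv_atTop_zero.pow 2).add_const 1).sqrt).inv₀ (by norm_num)
  norm_num at h
  refine h.congr' ?_
  filter_upwards [eventually_gt_atTop 0] with r hr
  have : 1 + r ^ 2 = r ^ 2 * ((r ^ 2)⁻¹ + 1) := by field_simp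
  rw [this, Real.sqrt_mul (by positivity), Real.sqrt_sq hr.le]
  field_simp

lemma hasDerivAt_div_sqrt_one_add_sq_pow (r : ℝ) :
    HasDerivAt (fun r : ℝ => (r / √(1 + r ^ 2)) ^ 3 / 3) (r ^ 2 * (√(1 + r ^ 2) ^ 5)⁻¹) r := by
  have hr : 0 < √(1 + r ^ 2) := Real.sqrt_pos.2 (by positivity)
  have h : HasDerivAt (fun r : ℝ => √(1 + r ^ 2)) _ r :=
    ((hasDerivAt_pow 2 r).const_add 1).sqrt (by positivity)
  refine ((((hasDerivAt_id r).div h hr.ne').pow 3).div_const 3).congr_deriv ?_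
  have h2 : √(1 + r ^ 2) ^ 2 = 1 + r ^ 2 := Real.sq_sqrt (by positivity)
  simp only [id, Pi.div_apply, Nat.add_one_sub_one, div_pow, pow_one]
  set q := √(1 + r ^ 2)
  field_simp
  push_cast
  linear_combination 6 * r ^ 2 * h2

lemma integrable_inv_sqrt_one_add_norm_sq_pow :
    Integrable (fun y : E3 => (√(1 + ‖y‖ ^ 2) ^ 5)⁻¹) := by
  refine (integrable_fun_norm_addHaar (E := E3) volume (f := fun r => (√(1 + r ^ 2) ^ 5)⁻¹)).2 ?_
  simp only [finrank_euclideanSpace_fin, smul_eq_mul]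
  exact integrableOn_Ioi_deriv_of_nonneg' (fun r _ => hasDerivAt_div_sqrt_one_add_sq_pow r)
    (fun r _ => show 0 ≤ r ^ 2 * (√(1 + r ^ 2) ^ 5)⁻¹ by positivity)
    ((tendsto_div_sqrt_one_add_sq.pow 3).div_const 3)

lemma integral_inv_sqrt_one_add_norm_sq_pow :
    ∫ y : E3, (√(1 + ‖y‖ ^ 2) ^ 5)⁻¹ = 4 * Real.pi / 3 := by
  rw [integral_fun_norm_addHaar (E := E3) volume (fun r => (√(1 + r ^ 2) ^ 5)⁻¹)]
  simp only [finrank_euclideanSpace_fin, smul_eq_mul, Nat.add_one_sub_one]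
  have := integral_Ioi_of_hasDerivAt_of_nonneg'
    (fun r (_ : r ∈ Set.Ici (0 : ℝ)) => hasDerivAt_div_sqrt_one_add_sq_pow r)
    (fun r _ => by positivity) ((tendsto_div_sqrt_one_add_sq.pow 3).div_const 3)
  rw [this, Measure.real, EuclideanSpace.volume_ball_fin_three]
  simp [ENNReal.toReal_ofReal (show 0 ≤ Real.pi * 4 / 3 by positivity)]
  ring

lemma integrable_exp_neg_norm_div_norm {α : ℝ} (hα : 0 < α) :
    Integrable (fun x : E3 => Real.exp (-‖x‖ / α) / ‖x‖) := by
  refine (integrable_fun_norm_addHaar (E := E3) volume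
    (f := fun r => Real.exp (-r / α) / r)).2 ?_
  have h := integrableOn_rpow_mul_exp_neg_mul_rpow (p := 1) (s := 1) (b := α⁻¹) (by norm_num)
    (by norm_num) (by positivity)
  refine h.congr_fun (fun r hr => ?_) measurableSet_Ioi
  have hr : 0 < r := hr
  simp only [finrank_euclideanSpace_fin, smul_eq_mul, Real.rpow_one]
  rw [show -α⁻¹ * r = -r / α by field_simp]
  field_simp

lemma regularizedYukawa_le {α : ℝ} (hα : 0 < α) (ε : ℝ) {x : E3} (hx : x ≠ 0) :
    regularizedYukawa α ε x ≤ Real.exp (-‖x‖ / α) / ‖x‖ := by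
  have hx : 0 < ‖x‖ := norm_pos_iff.2 hx
  have h : ‖x‖ ≤ √(‖x‖ ^ 2 + ε ^ 2) := Real.le_sqrt_of_sq_le (by nlinarith [sq_nonneg ε])
  unfold regularizedYukawa
  gcongr

lemma exp_neg_mul_quadratic_le {t : ℝ} (ht : 0 ≤ t) :
    Real.exp (-t) * (t ^ 2 + 3 * t + 3) ≤ 6 := by
  rw [Real.exp_neg, inv_mul_le_iff₀ (Real.exp_pos t)]
  nlinarith [Real.quadratic_le_exp_of_nonneg ht]

open Filter Topology in
lemma tendsto_integral_regularizedYukawa {α : ℝ} (hα : 0 < α) {ψ : E3 → ℝ} (hψ : Continuous ψ)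
    (hsupp : HasCompactSupport ψ) :
    Tendsto (fun ε => ∫ x, regularizedYukawa α ε x * ψ x) (𝓝[>] 0)
      (𝓝 (∫ x, Real.exp (-‖x‖ / α) / ‖x‖ * ψ x)) := by
  obtain ⟨C, hC⟩ := hsupp.exists_bound_of_continuous hψ
  have hne : ∀ᵐ x : E3, x ≠ 0 := by
    rw [ae_iff]; simp
  refine tendsto_integral_filter_of_dominated_convergence
    (fun x => Real.exp (-‖x‖ / α) / ‖x‖ * C) ?_ ?_
    ((integrable_exp_neg_norm_div_norm hα).mul_const C) ?_
  · filter_upwards [self_mem_nhdsWithin] with ε hε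
    exact ((contDiff_regularizedYukawa (n := 0) hε).continuous.mul hψ).aestronglyMeasurable
  · refine Eventually.of_forall fun ε => ?_
    filter_upwards [hne] with x hx
    rw [norm_mul, Real.norm_of_nonneg (by unfold regularizedYukawa; positivity)]
    exact mul_le_mul (regularizedYukawa_le hα ε hx) (hC x) (norm_nonneg _) (by positivity)
  · filter_upwards [hne] with x hx
    have hx : 0 < ‖x‖ := norm_pos_iff.2 hx
    have h : ContinuousAt (fun ε => regularizedYukawa α ε x * ψ x) 0 := by
      have : √(‖x‖ ^ 2 + 0 ^ 2) ≠ 0 := by positivity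
      unfold regularizedYukawa
      fun_prop (disch := assumption)
    have h0 : regularizedYukawa α 0 x = Real.exp (-‖x‖ / α) / ‖x‖ := by
      simp [regularizedYukawa]
    have := h.tendsto
    rw [h0] at this
    exact this.mono_left nhdsWithin_le_nhds

lemma integral_regularizedYukawa_sub_lapE {α ε : ℝ} (hα : 0 < α) (hε : 0 < ε) (φ : E3 → ℝ) :
    ∫ x, (regularizedYukawa α ε x - α ^ 2 * lapE (regularizedYukawa α ε) x) * φ x =
      α ^ 2 * ∫ y : E3, Real.exp (-(ε * √(1 + ‖y‖ ^ 2) / α)) *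
        ((ε * √(1 + ‖y‖ ^ 2) / α) ^ 2 + 3 * (ε * √(1 + ‖y‖ ^ 2) / α) + 3) *
          (√(1 + ‖y‖ ^ 2) ^ 5)⁻¹ * φ (ε • y) := by
  have h := Measure.integral_comp_smul_of_nonneg (volume : Measure E3)
    (fun x => (regularizedYukawa α ε x - α ^ 2 * lapE (regularizedYukawa α ε) x) * φ x) ε
    (hR := hε.le)
  rw [finrank_euclideanSpace_fin, smul_eq_mul, eq_inv_mul_iff_mul_eq₀ (by positivity)] at h
  rw [← h, ← integral_const_mul, ← integral_const_mul]
  congr 1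
  ext y
  have hsqrt : √(‖ε • y‖ ^ 2 + ε ^ 2) = ε * √(1 + ‖y‖ ^ 2) := by
    rw [norm_smul, Real.norm_of_nonneg hε.le,
      show (ε * ‖y‖) ^ 2 + ε ^ 2 = ε ^ 2 * (1 + ‖y‖ ^ 2) by ring,
      Real.sqrt_mul (by positivity), Real.sqrt_sq hε.le]
  have hr : 0 < √(1 + ‖y‖ ^ 2) := Real.sqrt_pos.2 (by positivity)
  simp only [regularizedYukawa_sub_lapE hα hε, hsqrt, neg_div]
  field_simp

open Filter Topology in
lemma tendsto_integral_regularizedYukawa_sub_lapE {α : ℝ} (hα : 0 < α) {φ : E3 → ℝ}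
    (hφ : Continuous φ) (hsupp : HasCompactSupport φ) :
    Tendsto (fun ε => ∫ x, (regularizedYukawa α ε x -
      α ^ 2 * lapE (regularizedYukawa α ε) x) * φ x) (𝓝[>] 0)
      (𝓝 (4 * Real.pi * α ^ 2 * φ 0)) := by
  obtain ⟨C, hC⟩ := hsupp.exists_bound_of_continuous hφ
  have hlim : 4 * Real.pi * α ^ 2 * φ 0 =
      α ^ 2 * ∫ y : E3, 3 * (√(1 + ‖y‖ ^ 2) ^ 5)⁻¹ * φ 0 := by
    rw [integral_mul_const, integral_const_mul, integral_inv_sqrt_one_add_norm_sq_pow]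
    ring
  rw [hlim]
  refine Tendsto.congr' (eventually_nhdsWithin_of_forall fun ε (hε : 0 < ε) =>
    (integral_regularizedYukawa_sub_lapE hα hε φ).symm) (Tendsto.const_mul _ ?_)
  have hr (y : E3) : √(1 + ‖y‖ ^ 2) ^ 5 ≠ 0 := by positivity
  refine tendsto_integral_filter_of_dominated_convergence
    (fun y => 6 * (√(1 + ‖y‖ ^ 2) ^ 5)⁻¹ * C) ?_ ?_
    ((integrable_inv_sqrt_one_add_norm_sq_pow.const_mul 6).mul_const C) ?_
  · refine Eventually.of_forall fun ε => Continuous.aestronglyMeasurable ?_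
    fun_prop (disch := exact hr)
  · refine eventually_nhdsWithin_of_forall fun ε (hε : 0 < ε) => Eventually.of_forall fun y => ?_
    rw [norm_mul, Real.norm_of_nonneg (by positivity)]
    have := exp_neg_mul_quadratic_le (t := ε * √(1 + ‖y‖ ^ 2) / α) (by positivity)
    gcongr
    exact hC _
  · refine Eventually.of_forall fun y => ?_
    have h : Continuous (fun ε => Real.exp (-(ε * √(1 + ‖y‖ ^ 2) / α)) *
        ((ε * √(1 + ‖y‖ ^ 2) / α) ^ 2 + 3 * (ε * √(1 + ‖y‖ ^ 2) / α) + 3) *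
          (√(1 + ‖y‖ ^ 2) ^ 5)⁻¹ * φ (ε • y)) := by
      fun_prop
    simpa using (h.tendsto 0).mono_left nhdsWithin_le_nhds

/-- the Yukawa potential is the Green's function of the Helmholtz
operator `(1 − α²Δ)` in ℝ³. -/
theorem yukawa_green_function (α : ℝ) (hα : 0 < α) (φ : E3 → ℝ)
    (hφ : ContDiff ℝ (⊤ : ℕ∞) φ) (hsupp : HasCompactSupport φ) :
    Integrable (fun x : E3 => gA α x * (φ x - α ^ 2 * lapE φ x)) ∧
    (∫ x : E3, gA α x * (φ x - α ^ 2 * lapE φ x)) = φ 0 := by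
  have hφ₂ : ContDiff ℝ 2 φ := contDiff_infty.1 hφ 2
  set ψ : E3 → ℝ := fun x => φ x - α ^ 2 * lapE φ x
  have hψ : Continuous ψ := hφ.continuous.sub (continuous_const.mul (continuous_lapE hφ₂))
  have hψs : HasCompactSupport ψ := hsupp.sub (hasCompactSupport_lapE hsupp).mul_left
  have hg : ∀ x, gA α x * ψ x =
      (4 * Real.pi * α ^ 2)⁻¹ * (Real.exp (-‖x‖ / α) / ‖x‖ * ψ x) := by
    intro x
    rw [gA, div_mul_eq_div_div_swap]
    ring
  obtain ⟨C, hC⟩ := hψs.exists_bound_of_continuous hψ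
  have hint := (integrable_exp_neg_norm_div_norm hα).mul_bdd hψ.aestronglyMeasurable
    (Filter.Eventually.of_forall hC)
  change Integrable (fun x => gA α x * ψ x) ∧ ∫ x, gA α x * ψ x = φ 0
  simp only [hg]
  refine ⟨hint.const_mul _, ?_⟩
  have heq : ∀ ε : ℝ, 0 < ε → ∫ x, regularizedYukawa α ε x * ψ x =
      ∫ x, (regularizedYukawa α ε x - α ^ 2 * lapE (regularizedYukawa α ε) x) * φ x := by
    intro ε hε
    have hr : ContDiff ℝ 2 (regularizedYukawa α ε) := contDiff_regularizedYukawa hε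
    have h₁ : Integrable (fun x => regularizedYukawa α ε x * φ x) :=
      (hr.continuous.mul hφ.continuous).integrable_of_hasCompactSupport
        hsupp.mul_left
    have h₂ : Integrable (fun x => regularizedYukawa α ε x * lapE φ x) :=
      (hr.continuous.mul (continuous_lapE hφ₂)).integrable_of_hasCompactSupport
        (hasCompactSupport_lapE hsupp).mul_left
    have h₃ : Integrable (fun x => lapE (regularizedYukawa α ε) x * φ x) :=
      ((continuous_lapE hr).mul hφ.continuous).integrable_of_hasCompactSupport
        hsupp.mul_left
    calc ∫ x, regularizedYukawa α ε x * ψ x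
        = ∫ x, (regularizedYukawa α ε x * φ x -
            α ^ 2 * (regularizedYukawa α ε x * lapE φ x)) := by
          congr 1; ext x; simp only [ψ]; ring
      _ = ∫ x, (regularizedYukawa α ε x * φ x -
            α ^ 2 * (lapE (regularizedYukawa α ε) x * φ x)) := by
          rw [integral_sub h₁ (h₂.const_mul _), integral_sub h₁ (h₃.const_mul _),
            integral_const_mul, integral_const_mul, integral_mul_lapE hr hφ₂ hsupp]
      _ = _ := by
          congr 1; ext x; ring
  have hlim := tendsto_nhds_unique (tendsto_integral_regularizedYukawa hα hψ hψs)
    ((tendsto_integral_regularizedYukawa_sub_lapE hα hφ.continuous hsupp).congr'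
      (eventually_nhdsWithin_of_forall fun ε hε => (heq ε hε).symm))
  rw [integral_const_mul, hlim]
  have := Real.pi_pos
  field_simp
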